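/- arXiv:2410.01405 — 3 statements merged into one kernel-verified Lean document; each statement's English description precedes it below -/
import Mathlib

section
/- Let d, N ∈ ℕ and p ∈ [1,∞). There exists a constant C > 0 such that the hypothesis space H = { L₂ ∘ TF^{∘r} ∘ L₁ : [0,1]^{d×N} → ℝ^{d×N} }, where TF ranges over Transformer blocks on ℝ^{m×N} with embedding dimension m ≤ Cd, feed-forward width q ≤ Cd, two attention heads, head size 1, arbitrary real weights, arbitrary loop count r ∈ ℕ, and L₁: ℝ^d → ℝ^m, L₂: ℝ^m → ℝ^d ranging over token-wise affine maps, is dense in F_PE([0,1]^{d×N}) with respect to the L^p norm: for every f ∈ F_PE([0,1]^{d×N}) and every ε > 0 there is an element g ∈ H with ‖g − f‖_{L^p} < ε. -/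
open scoped BigOperators
open MeasureTheory Matrix

noncomputable section

/-- ReLU activation. -/
def relu (x : ℝ) : ℝ := max x 0

/-- Parameters of a feed-forward layer `FF(x) = W₂·ReLU(W₁x + b₁) + b₂`
of width `q` on `ℝ^m`. -/
structure FFParams (m q : ℕ) where
  W1 : Matrix (Fin q) (Fin m) ℝ
  W2 : Matrix (Fin m) (Fin q) ℝ
  b1 : Fin q → ℝ
  b2 : Fin m → ℝ

/-- Application of a feed-forward layer. -/
def FFParams.apply {m q : ℕ} (P : FFParams m q) (x : Fin m → ℝ) : Fin m → ℝ :=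
  P.W2.mulVec (fun j => relu (P.W1.mulVec x j + P.b1 j)) + P.b2

/-- Parameters of a self-attention layer with `h` heads and head size `s`
on `ℝ^{m×N}`. -/
structure AttnParams (m s h : ℕ) where
  WO : Fin h → Matrix (Fin m) (Fin s) ℝ
  WV : Fin h → Matrix (Fin s) (Fin m) ℝ
  WK : Fin h → Matrix (Fin s) (Fin m) ℝ
  WQ : Fin h → Matrix (Fin s) (Fin m) ℝ

/-- Apply a column map `σ` (e.g. softmax or hardmax) to each column of a
square matrix. -/
def colwise {N : ℕ} (σ : (Fin N → ℝ) → (Fin N → ℝ))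
    (A : Matrix (Fin N) (Fin N) ℝ) : Matrix (Fin N) (Fin N) ℝ :=
  Matrix.of fun i j => σ (fun k => A k j) i

/-- Self-attention: `Attn(X) = Σᵢ W_O^i W_V^i X σ[(W_K^i X)ᵀ W_Q^i X]`,
with `σ` applied columnwise. -/
def AttnParams.apply {m s h N : ℕ} (P : AttnParams m s h)
    (σ : (Fin N → ℝ) → (Fin N → ℝ)) (X : Matrix (Fin m) (Fin N) ℝ) :
    Matrix (Fin m) (Fin N) ℝ :=
  ∑ i : Fin h, P.WO i * (P.WV i * X) * colwise σ ((P.WK i * X)ᵀ * (P.WQ i * X))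

/-- Parameters of a Transformer block. -/
structure TFParams (m s h q : ℕ) where
  attn : AttnParams m s h
  ff : FFParams m q

/-- Transformer block: `TF(X) = X' + FF(X')` (tokenwise), `X' = X + Attn(X)`. -/
def TFParams.apply {m s h q N : ℕ} (P : TFParams m s h q)
    (σ : (Fin N → ℝ) → (Fin N → ℝ)) (X : Matrix (Fin m) (Fin N) ℝ) :
    Matrix (Fin m) (Fin N) ℝ :=
  let X' := X + P.attn.apply σ X
  X' + Matrix.of fun i j => P.ff.apply (fun k => X' k j) i

/-- Softmax applied to a column. -/
def softmaxCol {N : ℕ} (v : Fin N → ℝ) : Fin N → ℝ :=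
  fun i => Real.exp (v i) / ∑ j, Real.exp (v j)

open Classical in
/-- Hardmax applied to a column: the one-hot indicator of the (least) index
achieving the maximal entry. -/
def hardmaxCol {N : ℕ} (v : Fin N → ℝ) : Fin N → ℝ :=
  fun i => if (∀ j, v j ≤ v i) ∧ (∀ j, v j = v i → i ≤ j) then 1 else 0

/-- Token-wise (column-wise) application of the affine map `x ↦ Ax + b`. -/
def affineCols {m d N : ℕ} (A : Matrix (Fin m) (Fin d) ℝ) (b : Fin m → ℝ)
    (X : Matrix (Fin d) (Fin N) ℝ) : Matrix (Fin m) (Fin N) ℝ :=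
  Matrix.of fun i j => A.mulVec (fun k => X k j) i + b i

/-- The input cube `[0,1]^{d×N}`. -/
def cube (d N : ℕ) : Set (Matrix (Fin d) (Fin N) ℝ) :=
  {X | ∀ i j, X i j ∈ Set.Icc (0 : ℝ) 1}

/-- Entrywise `p`-norm of a matrix. -/
def pNorm {d N : ℕ} (p : ℝ) (X : Matrix (Fin d) (Fin N) ℝ) : ℝ :=
  (∑ i, ∑ j, |X i j| ^ p) ^ (1 / p)

/-- Entrywise `p`-norm of a vector. -/
def vpNorm {d : ℕ} (p : ℝ) (x : Fin d → ℝ) : ℝ :=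
  (∑ i, |x i| ^ p) ^ (1 / p)

/-- Entrywise `2`-norm of a matrix. -/
def twoNorm {d N : ℕ} (X : Matrix (Fin d) (Fin N) ℝ) : ℝ :=
  Real.sqrt (∑ i, ∑ j, X i j ^ 2)

/-- Entrywise `2`-norm of a vector. -/
def vtwoNorm {d : ℕ} (x : Fin d → ℝ) : ℝ :=
  Real.sqrt (∑ i, x i ^ 2)

/-- Modulus of sequence continuity
`ω_f(δ) = sup{‖f(X)−f(X')‖_p : X, X' ∈ [0,1]^{d×N}, ‖X−X'‖₂ ≤ δ}`. -/
def modSeq {d N : ℕ} (p : ℝ)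
    (f : Matrix (Fin d) (Fin N) ℝ → Matrix (Fin d) (Fin N) ℝ) (δ : ℝ) : ℝ :=
  sSup {t | ∃ X ∈ cube d N, ∃ X' ∈ cube d N,
    twoNorm (X - X') ≤ δ ∧ t = pNorm p (f X - f X')}

/-- Modulus of contextual continuity `ω^cont_f`. -/
def modCtx {d N : ℕ} (p : ℝ)
    (f : Matrix (Fin d) (Fin N) ℝ → Matrix (Fin d) (Fin N) ℝ) (δ : ℝ) : ℝ :=
  sSup {t | ∃ n : Fin N, ∃ X ∈ cube d N, ∃ X' ∈ cube d N,
    twoNorm (X - X') ≤ δ ∧ (∀ i, X i n = X' i n) ∧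
    t = vpNorm p (fun i => f X i n - f X' i n)}

/-- Modulus of token continuity `ω^tok_f`. -/
def modTok {d N : ℕ} (p : ℝ)
    (f : Matrix (Fin d) (Fin N) ℝ → Matrix (Fin d) (Fin N) ℝ) (δ : ℝ) : ℝ :=
  sSup {t | ∃ n : Fin N, ∃ X ∈ cube d N, ∃ X' ∈ cube d N,
    vtwoNorm (fun i => X i n - X' i n) ≤ δ ∧
    (∀ q, q ≠ n → ∀ i, X i q = X' i q) ∧
    t = vpNorm p (fun i => f X i n - f X' i n)}

instance matrixMeasureSpace (d N : ℕ) :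
    MeasureSpace (Matrix (Fin d) (Fin N) ℝ) :=
  inferInstanceAs (MeasureSpace (Fin d → Fin N → ℝ))

/-- `L^p` norm of `g` over the cube `[0,1]^{d×N}`:
`(∫_{[0,1]^{d×N}} ‖g(X)‖_p^p dX)^{1/p}`. -/
def LpNormOn {d N : ℕ} (p : ℝ)
    (g : Matrix (Fin d) (Fin N) ℝ → Matrix (Fin d) (Fin N) ℝ) : ℝ :=
  (∫ X in cube d N, pNorm p (g X) ^ p) ^ (1 / p)

/-- Permutation equivariance on the cube: `f(XP) = f(X)P` for every
permutation matrix `P`, expressed via column permutations. -/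
def PermEquivariant {d N : ℕ}
    (f : Matrix (Fin d) (Fin N) ℝ → Matrix (Fin d) (Fin N) ℝ) : Prop :=
  ∀ σ : Equiv.Perm (Fin N), ∀ X ∈ cube d N,
    f (X.submatrix id σ) = (f X).submatrix id σ

/-- The looped network `L₂ ∘ TF^{∘r} ∘ L₁` with token-wise affine maps. -/
def loopedNet {d m N s h q : ℕ} (σ : (Fin N → ℝ) → (Fin N → ℝ))
    (P : TFParams m s h q)
    (A1 : Matrix (Fin m) (Fin d) ℝ) (b1 : Fin m → ℝ)
    (A2 : Matrix (Fin d) (Fin m) ℝ) (b2 : Fin d → ℝ) (r : ℕ)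
    (X : Matrix (Fin d) (Fin N) ℝ) : Matrix (Fin d) (Fin N) ℝ :=
  affineCols A2 b2 ((P.apply σ)^[r] (affineCols A1 b1 X))

end

/-! ### Realizing a coordinate-free block -/

/-- One Transformer block with uniform attention, written on an abstract state space: every token
receives the sum of the values `v` of all tokens along `o`, then a ReLU layer is applied. -/
noncomputable def blockStep {E κ : Type*} [AddCommGroup E] [Module ℝ E] [Fintype κ] {N : ℕ}
    (v : E →ₗ[ℝ] ℝ) (o : E) (α : κ → E →ₗ[ℝ] ℝ) (β : κ → ℝ) (W : κ → E) (b : E)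
    (Y : Fin N → E) (n : Fin N) : E :=
  let z := Y n + (∑ j, v (Y j)) • o
  z + (∑ l, relu (α l z + β l) • W l + b)

lemma sum_map_symm_single {m : ℕ} {E : Type*} [AddCommGroup E] [Module ℝ E]
    (φ : E ≃ₗ[ℝ] (Fin m → ℝ)) (v : E →ₗ[ℝ] ℝ) (x : E) :
    ∑ k, v (φ.symm (Pi.single k 1)) * φ x k = v x := by
  have h := LinearMap.pi_apply_eq_sum_univ (v ∘ₗ φ.symm.toLinearMap) (φ x)
  simp only [LinearMap.comp_apply, LinearEquiv.coe_coe, LinearEquiv.symm_apply_apply] at h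
  rw [h]
  refine Finset.sum_congr rfl fun k _ => ?_
  rw [smul_eq_mul, mul_comm]
  congr 4
  ext j
  simp [Pi.single_apply, eq_comm]

lemma softmaxCol_zero {N : ℕ} (i : Fin N) : softmaxCol (fun _ : Fin N => (0 : ℝ)) i = 1 / N := by
  simp [softmaxCol]

lemma exists_loopedNet_eq {d N : ℕ} {E κ : Type*} [AddCommGroup E] [Module ℝ E]
    [FiniteDimensional ℝ E] [Fintype κ]
    (v : E →ₗ[ℝ] ℝ) (o : E) (α : κ → E →ₗ[ℝ] ℝ) (β : κ → ℝ) (W : κ → E) (b : E)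
    (inp : (Fin d → ℝ) →ₗ[ℝ] E) (y₀ : E) (out : E →ₗ[ℝ] (Fin d → ℝ)) (b2 : Fin d → ℝ) :
    ∃ (P : TFParams (Module.finrank ℝ E) 1 2 (Fintype.card κ))
      (A1 : Matrix (Fin (Module.finrank ℝ E)) (Fin d) ℝ) (b1 : Fin (Module.finrank ℝ E) → ℝ)
      (A2 : Matrix (Fin d) (Fin (Module.finrank ℝ E)) ℝ),
      ∀ (r : ℕ) (X : Matrix (Fin d) (Fin N) ℝ),
        loopedNet softmaxCol P A1 b1 A2 b2 r X = Matrix.of fun i n =>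
          out ((blockStep v o α β W b)^[r] (fun n => inp (fun k => X k n) + y₀) n) i + b2 i := by
  let φ : E ≃ₗ[ℝ] (Fin (Module.finrank ℝ E) → ℝ) := (Module.finBasis ℝ E).equivFun
  let e : κ ≃ Fin (Fintype.card κ) := Fintype.equivFin κ
  let P : TFParams (Module.finrank ℝ E) 1 2 (Fintype.card κ) :=
    { attn :=
        { WO := ![Matrix.of fun i _ => N * φ o i, 0]
          WV := ![Matrix.of fun _ k => v (φ.symm (Pi.single k 1)), 0]
          WK := 0
          WQ := 0 }
      ff :=
        { W1 := Matrix.of fun l k => α (e.symm l) (φ.symm (Pi.single k 1))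
          W2 := Matrix.of fun i l => φ (W (e.symm l)) i
          b1 := fun l => β (e.symm l)
          b2 := φ b } }
  have hattn (Y : Fin N → E) (i : Fin (Module.finrank ℝ E)) (n : Fin N) :
      P.attn.apply softmaxCol (Matrix.of fun i n => φ (Y n) i) i n
        = φ ((∑ j, v (Y j)) • o) i := by
    have hN : (N : ℝ) ≠ 0 := by
      have := n.pos
      positivity
    have hval (j : Fin N) :
        (P.attn.WV 0 * (Matrix.of fun i n => φ (Y n) i)) 0 j = v (Y j) := by
      simp [P, Matrix.mul_apply, sum_map_symm_single φ v]
    have hsm (j : Fin N) : colwise softmaxCol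
        ((P.attn.WK 0 * (Matrix.of fun i n => φ (Y n) i))ᵀ *
          (P.attn.WQ 0 * (Matrix.of fun i n => φ (Y n) i))) j n = 1 / N := by
      simp only [P, colwise, Matrix.of_apply]
      simpa using softmaxCol_zero j
    have h1 : P.attn.WO 1 = 0 := rfl
    rw [AttnParams.apply, Fin.sum_univ_two, h1]
    simp only [Matrix.zero_mul, add_zero]
    rw [Matrix.mul_apply]
    simp only [hsm]
    simp only [Matrix.mul_apply (M := P.attn.WO 0), Fin.sum_univ_one, Fin.isValue, hval]
    simp only [P, Matrix.cons_val_zero, Matrix.of_apply, map_smul, Pi.smul_apply, smul_eq_mul,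
      Finset.sum_mul]
    refine Finset.sum_congr rfl fun j _ => ?_
    field_simp
  have hff (z : E) : P.ff.apply (φ z) = φ (∑ l, relu (α l z + β l) • W l + b) := by
    ext i
    simp only [FFParams.apply, P, Pi.add_apply, map_add, map_sum, map_smul, Finset.sum_apply,
      Pi.smul_apply, smul_eq_mul, Matrix.mulVec, dotProduct, Matrix.of_apply,
      sum_map_symm_single φ]
    congr 1
    rw [← Equiv.sum_comp e]
    refine Finset.sum_congr rfl fun l _ => ?_
    simp [mul_comm]
  have hstep (Y : Fin N → E) : P.apply softmaxCol (Matrix.of fun i n => φ (Y n) i)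
      = Matrix.of fun i n => φ (blockStep v o α β W b Y n) i := by
    have hZ : (Matrix.of fun i n => φ (Y n) i) +
        P.attn.apply softmaxCol (Matrix.of fun i n => φ (Y n) i)
        = Matrix.of fun i n => φ (Y n + (∑ j, v (Y j)) • o) i := by
      ext i n
      rw [Matrix.add_apply, hattn]
      simp
    ext i n
    simp only [TFParams.apply, hZ]
    simp only [Matrix.add_apply, Matrix.of_apply]
    rw [hff]
    simp [blockStep]
  refine ⟨P, Matrix.of fun i k => φ (inp (Pi.single k 1)) i, φ y₀,
    Matrix.of fun i k => out (φ.symm (Pi.single k 1)) i, fun r X => ?_⟩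
  have hin : affineCols (Matrix.of fun i k => φ (inp (Pi.single k 1)) i) (φ y₀) X
      = Matrix.of fun i n => φ (inp (fun k => X k n) + y₀) i := by
    ext i n
    simp only [affineCols, Matrix.of_apply, map_add, Pi.add_apply]
    congr 1
    have := sum_map_symm_single (LinearEquiv.refl ℝ (Fin d → ℝ))
      (LinearMap.proj i ∘ₗ φ.toLinearMap ∘ₗ inp) (fun k => X k n)
    simpa [Matrix.mulVec, dotProduct] using this
  have hiter : ∀ (r : ℕ) (Y : Fin N → E),
      (P.apply softmaxCol)^[r] (Matrix.of fun i n => φ (Y n) i)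
        = Matrix.of fun i n => φ ((blockStep v o α β W b)^[r] Y n) i := by
    intro r
    induction r with
    | zero => intro Y; rfl
    | succ r ih => intro Y; rw [Function.iterate_succ_apply, hstep, ih, Function.iterate_succ_apply]
  ext i n
  rw [loopedNet, hin, hiter]
  simp only [affineCols, Matrix.of_apply]
  congr 1
  have := sum_map_symm_single φ (LinearMap.proj i ∘ₗ out)
    ((blockStep v o α β W b)^[r] (fun n => inp (fun k => X k n) + y₀) n)
  simpa [Matrix.mulVec, dotProduct] using this

/-! ### Lookup by the tent map -/

/-- The tent map for `s = 0`, the identity on `[0,1]` for `1 ≤ s`. -/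
noncomputable def gatedTent (s w : ℝ) : ℝ := w + relu (w - s) - 4 * relu (w - 1 / 2 - s / 2)

lemma relu_nonneg (x : ℝ) : 0 ≤ relu x := le_max_right _ _

lemma relu_of_nonneg {x : ℝ} (h : 0 ≤ x) : relu x = x := max_eq_left h

lemma relu_of_nonpos {x : ℝ} (h : x ≤ 0) : relu x = 0 := max_eq_right h

lemma relu_sub_relu_neg (x : ℝ) : relu x - relu (-x) = x := by
  rcases le_total 0 x with h | h
  · rw [relu_of_nonneg h, relu_of_nonpos (by linarith), sub_zero]
  · rw [relu_of_nonpos h, relu_of_nonneg (by linarith)]; ring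

lemma gatedTent_mem {s w : ℝ} (hs : 0 ≤ s) (hw : w ∈ Set.Icc (0 : ℝ) 1) :
    gatedTent s w ∈ Set.Icc (0 : ℝ) 1 := by
  obtain ⟨h0, h1⟩ := hw
  unfold gatedTent
  rcases le_total (w - s) 0 with h | h <;> rcases le_total (w - 1 / 2 - s / 2) 0 with h' | h'
  · rw [relu_of_nonpos h, relu_of_nonpos h']; constructor <;> linarith
  · rw [relu_of_nonpos h, relu_of_nonneg h']; constructor <;> linarith
  · rw [relu_of_nonneg h, relu_of_nonpos h']; constructor <;> linarith
  · rw [relu_of_nonneg h, relu_of_nonneg h']; constructor <;> linarith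

lemma gatedTent_of_one_le {s w : ℝ} (hs : 1 ≤ s) (hw : w ≤ 1) : gatedTent s w = w := by
  unfold gatedTent
  rw [relu_of_nonpos (by linarith), relu_of_nonpos (by linarith)]
  ring

/-- Points whose `L`-th tent iterate is prescribed are `2⁻ᴸ`-dense in `[0,1]`. -/
lemma exists_tent_iterate_eq (L : ℕ) : ∀ a ∈ Set.Icc (0 : ℝ) 1, ∀ y ∈ Set.Icc (0 : ℝ) 1,
    ∃ w ∈ Set.Icc (0 : ℝ) 1, |w - a| ≤ (1 / 2) ^ L ∧ (gatedTent 0)^[L] w = y := by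
  induction L with
  | zero =>
    rintro a ⟨ha0, ha1⟩ y hy
    refine ⟨y, hy, ?_, rfl⟩
    rw [pow_zero, abs_le]
    constructor <;> linarith [hy.1, hy.2]
  | succ L ih =>
    rintro a ⟨ha0, ha1⟩ y hy
    rcases le_total a (1 / 2) with h | h
    · obtain ⟨w, hw, hwa, hwy⟩ := ih (2 * a) ⟨by linarith, by linarith⟩ y hy
      refine ⟨w / 2, ⟨by linarith [hw.1], by linarith [hw.2]⟩, ?_, ?_⟩
      · rw [abs_le] at hwa ⊢
        rw [pow_succ]
        constructor <;> linarith [hwa.1, hwa.2]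
      · rw [Function.iterate_succ_apply]
        convert hwy using 2
        unfold gatedTent
        rw [relu_of_nonneg (by linarith [hw.1]), relu_of_nonpos (by linarith [hw.2])]
        ring
    · obtain ⟨w, hw, hwa, hwy⟩ := ih (2 - 2 * a) ⟨by linarith, by linarith⟩ y hy
      refine ⟨1 - w / 2, ⟨by linarith [hw.2], by linarith [hw.1]⟩, ?_, ?_⟩
      · rw [abs_le] at hwa ⊢
        rw [pow_succ]
        constructor <;> linarith [hwa.1, hwa.2]
      · rw [Function.iterate_succ_apply]
        convert hwy using 2
        unfold gatedTent
        rw [relu_of_nonneg (by linarith [hw.2]), relu_of_nonneg (by linarith [hw.2])]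
        ring

/-- A single tent orbit stores a finite table. -/
lemma exists_tent_orbit (L U : ℕ) : ∀ a : ℕ → ℝ, (∀ u, a u ∈ Set.Icc (0 : ℝ) 1) →
    ∃ w ∈ Set.Icc (0 : ℝ) 1, ∀ u ≤ U, |(gatedTent 0)^[L * u] w - a u| ≤ (1 / 2) ^ L := by
  induction U with
  | zero =>
    intro a ha
    refine ⟨a 0, ha 0, fun u hu => ?_⟩
    obtain rfl : u = 0 := by omega
    simp
  | succ U ih =>
    intro a ha
    obtain ⟨w', hw', htail⟩ := ih (fun u => a (u + 1)) (fun u => ha _)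
    obtain ⟨w, hw, hwa, hww⟩ := exists_tent_iterate_eq L (a 0) (ha 0) w' hw'
    refine ⟨w, hw, fun u hu => ?_⟩
    cases u with
    | zero => simpa using hwa
    | succ u =>
      rw [mul_add, mul_one, Function.iterate_add_apply, hww]
      exact htail u (by omega)

/-! ### Encoding a sequence of grid tokens up to permutation -/

lemma exists_perm_of_sum_pow_eq {N Z : ℕ} (g g' : Fin N → Fin Z)
    (h : ∑ j, (N + 1) ^ (g j : ℕ) = ∑ j, (N + 1) ^ (g' j : ℕ)) :
    ∃ σ : Equiv.Perm (Fin N), ∀ j, g (σ j) = g' j := by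
  let count (g : Fin N → Fin Z) (z : Fin Z) : Fin (N + 1) :=
    ⟨(Finset.univ.filter fun j => g j = z).card,
      Nat.lt_succ_of_le ((Finset.card_le_univ _).trans_eq (Fintype.card_fin N))⟩
  have hsum (g : Fin N → Fin Z) :
      ∑ j, (N + 1) ^ (g j : ℕ) = (finFunctionFinEquiv (count g) : ℕ) := by
    rw [finFunctionFinEquiv_apply, ← Finset.sum_fiberwise Finset.univ g]
    refine Finset.sum_congr rfl fun z _ => ?_
    rw [Finset.sum_congr rfl (g := fun _ => (N + 1) ^ (z : ℕ))
      (fun j hj => by rw [(Finset.mem_filter.1 hj).2])]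
    simp [count]
  rw [hsum, hsum] at h
  have hc := finFunctionFinEquiv.injective (Fin.ext h)
  have hcard (z : Fin Z) : Nonempty ({j // g' j = z} ≃ {j // g j = z}) := by
    refine ⟨Fintype.equivOfCardEq ?_⟩
    rw [Fintype.card_subtype, Fintype.card_subtype]
    exact (congrArg Fin.val (congrFun hc z)).symm
  exact ⟨Equiv.ofFiberEquiv fun z => (hcard z).some, fun j => Equiv.ofFiberEquiv_map _ j⟩

/-- The number of a grid token. -/
def tokenCode {K d : ℕ} (k : Fin d → Fin (K + 1)) : ℕ := finFunctionFinEquiv k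

/-- The number of a grid token together with the multiset of all tokens. -/
def contextCode {K d N : ℕ} (k : Fin N → Fin d → Fin (K + 1)) (n : Fin N) : ℕ :=
  (K + 1) ^ d * ∑ j, (N + 1) ^ (K + 1 + tokenCode (k j)) + tokenCode (k n)

lemma tokenCode_lt {K d : ℕ} (k : Fin d → Fin (K + 1)) : tokenCode k < (K + 1) ^ d :=
  (finFunctionFinEquiv k).2

lemma exists_perm_of_contextCode_eq {K d N : ℕ} (k k' : Fin N → Fin d → Fin (K + 1))
    (n n' : Fin N) (h : contextCode k n = contextCode k' n') :
    ∃ σ : Equiv.Perm (Fin N), (∀ j, k (σ j) = k' j) ∧ σ n' = n := by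
  unfold contextCode at h
  have hmod := congrArg (· % (K + 1) ^ d) h
  have hdiv := congrArg (· / (K + 1) ^ d) h
  have hpos : 0 < (K + 1) ^ d := by positivity
  simp only [Nat.mul_add_mod, Nat.mod_eq_of_lt (tokenCode_lt _)] at hmod
  simp only [Nat.mul_add_div hpos, Nat.div_eq_of_lt (tokenCode_lt _), add_zero, pow_add _ (K + 1),
    ← Finset.mul_sum] at hdiv
  have hdiv' := Nat.eq_of_mul_eq_mul_left (by positivity) hdiv
  obtain ⟨σ, hσ⟩ := exists_perm_of_sum_pow_eq
    (fun j => finFunctionFinEquiv (k j)) (fun j => finFunctionFinEquiv (k' j)) hdiv'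
  have hperm (j : Fin N) : k (σ j) = k' j := finFunctionFinEquiv.injective (hσ j)
  have hn : k n = k' n' := finFunctionFinEquiv.injective (Fin.ext hmod)
  refine ⟨σ.trans (Equiv.swap (σ n') n), fun j => ?_, by simp⟩
  rw [Equiv.trans_apply, Equiv.swap_apply_def]
  split_ifs with h1 h2
  · rw [σ.injective h1, hn]
  · rw [hperm n', ← hn, ← h2, hperm j]
  · exact hperm j

/-! ### The looped program -/

/-- State of a token: the input `x`, the lookup orbits `w`, the clock `t`, the token number `z`, the
power `y` of the token number with its stopping gate `h`, and the gate `s` of the lookup. -/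
structure TokenState (d : ℕ) where
  x : Fin d → ℝ
  w : Fin d → ℝ
  t : ℝ
  z : ℝ
  h : ℝ
  y : ℝ
  s : ℝ

/-- Continuous approximation of the Heaviside function, with slope `a`. -/
noncomputable def ramp (a x : ℝ) : ℝ := relu (a * x) - relu (a * x - 1)

/-- One round of the program. -/
noncomputable def programStep {d N : ℕ} (K L M T : ℕ) (a : ℝ) (Y : Fin N → TokenState d)
    (n : Fin N) : TokenState d where
  x := (Y n).x
  w := fun i => gatedTent (Y n).s ((Y n).w i)
  t := (Y n).t + 1
  z := (Y n).z + ∑ i : Fin d, (K + 1 : ℝ) ^ (i : ℕ) * ramp a ((Y n).x i - (Y n).t / K)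
  h := relu (1 - (K + (Y n).z - (Y n).t))
  y := (Y n).y + relu (N * (Y n).y - M * (Y n).h)
  s := relu (1 - ((Y n).t - T + L * ((K + 1 : ℝ) ^ d * ∑ j, (Y j).y + (Y n).z)))

/-- Initial state of the program. -/
def programInit {d N : ℕ} (w₀ : Fin d → ℝ) (X : Matrix (Fin d) (Fin N) ℝ) (n : Fin N) :
    TokenState d where
  x := fun k => X k n
  w := w₀
  t := 0
  z := 0
  h := 0
  y := 1
  s := 1

/-- The linear state space of a token; one register is reserved for the attention output. -/
abbrev StateSpace (d : ℕ) : Type := (Fin d → ℝ) × (Fin d → ℝ) × (Fin 6 → ℝ)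

/-- The state as a vector. -/
def TokenState.toVec {d : ℕ} (Y : TokenState d) : StateSpace d :=
  (Y.x, Y.w, ![Y.t, Y.z, Y.h, Y.y, 0, Y.s])

/-- Index type of the hidden units. -/
abbrev HiddenUnit (d : ℕ) : Type := Fin d ⊕ Fin d ⊕ Fin d ⊕ Fin d ⊕ Fin 9

section Weights

variable (d : ℕ)

/-- Input coordinate `i`. -/
def inputCoord (i : Fin d) : StateSpace d →ₗ[ℝ] ℝ := LinearMap.proj i ∘ₗ LinearMap.fst ℝ _ _

/-- Lookup coordinate `i`. -/
def lookupCoord (i : Fin d) : StateSpace d →ₗ[ℝ] ℝ :=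
  LinearMap.proj i ∘ₗ LinearMap.fst ℝ _ _ ∘ₗ LinearMap.snd ℝ _ _

/-- Register `i`. -/
def regCoord (i : Fin 6) : StateSpace d →ₗ[ℝ] ℝ :=
  LinearMap.proj i ∘ₗ LinearMap.snd ℝ _ _ ∘ₗ LinearMap.snd ℝ _ _

/-- Unit vector of register `i`. -/
def regVec (i : Fin 6) : StateSpace d := (0, 0, Pi.single i 1)

/-- Linear parts of the hidden units. -/
noncomputable def hiddenLin (N K L M : ℕ) (a : ℝ) : HiddenUnit d → StateSpace d →ₗ[ℝ] ℝ :=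
  Sum.elim (fun i => a • (inputCoord d i - (K : ℝ)⁻¹ • regCoord d 0)) <|
  Sum.elim (fun i => a • (inputCoord d i - (K : ℝ)⁻¹ • regCoord d 0)) <|
  Sum.elim (fun i => lookupCoord d i - regCoord d 5) <|
  Sum.elim (fun i => lookupCoord d i - (1 / 2 : ℝ) • regCoord d 5)
    ![regCoord d 2, -regCoord d 2, regCoord d 0 - regCoord d 1,
      (N : ℝ) • regCoord d 3 - (M : ℝ) • regCoord d 2,
      regCoord d 4, -regCoord d 4, regCoord d 5, -regCoord d 5,
      -regCoord d 0 - (L : ℝ) • ((K + 1 : ℝ) ^ d • regCoord d 4 + regCoord d 1)]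

/-- Biases of the hidden units. -/
noncomputable def hiddenBias (K T : ℕ) : HiddenUnit d → ℝ :=
  Sum.elim (fun _ => 0) <| Sum.elim (fun _ => -1) <| Sum.elim (fun _ => 0) <|
  Sum.elim (fun _ => -(1 / 2)) ![0, 0, 1 - K, 0, 0, 0, 0, 0, 1 + T]

/-- Output vectors of the hidden units. -/
noncomputable def hiddenOut (K : ℕ) : HiddenUnit d → StateSpace d :=
  Sum.elim (fun i => (K + 1 : ℝ) ^ (i : ℕ) • regVec d 1) <|
  Sum.elim (fun i => -((K + 1 : ℝ) ^ (i : ℕ)) • regVec d 1) <|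
  Sum.elim (fun i => (0, Pi.single i 1, 0)) <|
  Sum.elim (fun i => (0, Pi.single i (-4), 0))
    ![-regVec d 2, regVec d 2, regVec d 2, regVec d 3, -regVec d 4, regVec d 4, -regVec d 5,
      regVec d 5, regVec d 5]

end Weights

lemma blockStep_toVec {d N : ℕ} (K L M T : ℕ) (a : ℝ) (Y : Fin N → TokenState d) (n : Fin N) :
    blockStep (regCoord d 3) (regVec d 4) (hiddenLin d N K L M a) (hiddenBias d K T)
      (hiddenOut d K) (regVec d 0) (fun n => (Y n).toVec) n
      = (programStep K L M T a Y n).toVec := by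
  have hz : (Y n).toVec + (∑ j, regCoord d 3 (Y j).toVec) • regVec d 4
      = ((Y n).x, (Y n).w,
        ![(Y n).t, (Y n).z, (Y n).h, (Y n).y, ∑ j, (Y j).y, (Y n).s]) := by
    refine Prod.ext ?_ (Prod.ext ?_ ?_)
    · simp [TokenState.toVec, regVec]
    · simp [TokenState.toVec, regVec]
    · ext i
      fin_cases i <;> simp [TokenState.toVec, regVec, regCoord, vecHead, vecTail]
  simp only [blockStep, hz]
  refine Prod.ext ?_ (Prod.ext ?_ ?_)
  · ext i
    simp [hiddenOut, regVec, TokenState.toVec, programStep, Fin.sum_univ_succ, Prod.fst_sum]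
  · ext i
    simp [hiddenLin, hiddenBias, hiddenOut, regVec, regCoord, lookupCoord,
      TokenState.toVec, programStep, Fin.sum_univ_succ, Prod.fst_sum, Prod.snd_sum, gatedTent,
      Finset.sum_apply, Pi.single_apply]
    ring_nf
  · have reset (x y : ℝ) : x + (-relu x + (relu (-x) + y)) = y := by
      linarith [relu_sub_relu_neg x]
    ext i
    fin_cases i <;>
    simp [hiddenLin, hiddenBias, hiddenOut, regVec, regCoord, inputCoord,
      TokenState.toVec, programStep, Fin.sum_univ_succ, Prod.snd_sum, Finset.sum_apply, ramp, reset]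
    · rw [← sub_eq_add_neg, ← Finset.sum_sub_distrib]
      refine Finset.sum_congr rfl fun i _ => ?_
      rw [div_eq_inv_mul, sub_eq_add_neg (a * _) 1]
      ring
    · congr 1
      ring
    · simpa using reset (∑ j, (Y j).y) 0
    · congr 1
      ring

lemma exists_loopedNet_eq_program {d N : ℕ} (K L M T : ℕ) (a : ℝ) (w₀ : Fin d → ℝ)
    (c₁ c₂ : ℝ) :
    ∃ (P : TFParams (2 * d + 6) 1 2 (4 * d + 9))
      (A1 : Matrix (Fin (2 * d + 6)) (Fin d) ℝ) (b1 : Fin (2 * d + 6) → ℝ)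
      (A2 : Matrix (Fin d) (Fin (2 * d + 6)) ℝ) (b2 : Fin d → ℝ),
      ∀ (r : ℕ) (X : Matrix (Fin d) (Fin N) ℝ) (i : Fin d) (n : Fin N),
        loopedNet softmaxCol P A1 b1 A2 b2 r X i n
          = c₁ * ((programStep K L M T a)^[r] (programInit w₀ X) n).w i + c₂ := by
  have hm : Module.finrank ℝ (StateSpace d) = 2 * d + 6 := by
    simp
    omega
  have hq : Fintype.card (HiddenUnit d) = 4 * d + 9 := by
    simp
    omega
  obtain ⟨P, A1, b1, A2, hP⟩ := exists_loopedNet_eq (N := N) (regCoord d 3) (regVec d 4)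
    (hiddenLin d N K L M a) (hiddenBias d K T) (hiddenOut d K) (regVec d 0)
    (LinearMap.inl ℝ _ _) ((0, w₀, ![0, 0, 0, 1, 0, 1]) : StateSpace d)
    (c₁ • (LinearMap.fst ℝ _ _ ∘ₗ LinearMap.snd ℝ _ _)) (fun _ => c₂)
  have hiter : ∀ (r : ℕ) (Y : Fin N → TokenState d),
      (blockStep (regCoord d 3) (regVec d 4) (hiddenLin d N K L M a) (hiddenBias d K T)
        (hiddenOut d K) (regVec d 0))^[r] (fun n => (Y n).toVec)
      = fun n => ((programStep K L M T a)^[r] Y n).toVec := by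
    intro r
    induction r with
    | zero => intro Y; rfl
    | succ r ih =>
      intro Y
      rw [Function.iterate_succ_apply, Function.iterate_succ_apply, ← ih]
      congr 1
      funext n
      exact blockStep_toVec K L M T a Y n
  have hstart (X : Matrix (Fin d) (Fin N) ℝ) :
      (fun n => LinearMap.inl ℝ (Fin d → ℝ) ((Fin d → ℝ) × (Fin 6 → ℝ)) (fun k => X k n)
        + ((0, w₀, ![0, 0, 0, 1, 0, 1]) : StateSpace d))
      = fun n => (programInit w₀ X n).toVec := by
    funext n
    simp [programInit, TokenState.toVec]
  rw [← hm, ← hq]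
  refine ⟨P, A1, b1, A2, fun _ => c₂, fun r X i n => ?_⟩
  rw [hP, hstart, hiter]
  simp [TokenState.toVec]

/-! ### Correctness of the program -/

lemma programStep_iterate_w_mem {d N : ℕ} (K L M T : ℕ) (a : ℝ) {w₀ : Fin d → ℝ}
    (hw₀ : ∀ i, w₀ i ∈ Set.Icc (0 : ℝ) 1) (X : Matrix (Fin d) (Fin N) ℝ) (r : ℕ) (n : Fin N)
    (i : Fin d) :
    ((programStep K L M T a)^[r] (programInit w₀ X) n).w i ∈ Set.Icc (0 : ℝ) 1 := by
  suffices h : 0 ≤ ((programStep K L M T a)^[r] (programInit w₀ X) n).s ∧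
      ((programStep K L M T a)^[r] (programInit w₀ X) n).w i ∈ Set.Icc (0 : ℝ) 1 from h.2
  induction r with
  | zero => exact ⟨zero_le_one, hw₀ i⟩
  | succ r ih =>
    rw [Function.iterate_succ_apply']
    exact ⟨relu_nonneg _, gatedTent_mem ih.1 ih.2⟩

/-- The value of the register `z` at time `t`. -/
def partialCode {K d : ℕ} (k : Fin d → Fin (K + 1)) (t : ℕ) : ℕ :=
  ∑ i : Fin d, (K + 1) ^ (i : ℕ) * min t (k i)

lemma partialCode_of_le {K d : ℕ} (k : Fin d → Fin (K + 1)) {t : ℕ} (ht : K ≤ t) :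
    partialCode k t = tokenCode k := by
  rw [partialCode, tokenCode, finFunctionFinEquiv_apply]
  refine Finset.sum_congr rfl fun i _ => ?_
  rw [min_eq_right (by have := (k i).2; omega), mul_comm]

lemma partialCode_mono {K d : ℕ} (k : Fin d → Fin (K + 1)) : Monotone (partialCode k) := by
  intro s t hst
  exact Finset.sum_le_sum fun i _ => Nat.mul_le_mul_left _ (min_le_min_right _ hst)

lemma partialCode_le {K d : ℕ} (k : Fin d → Fin (K + 1)) (t : ℕ) :
    partialCode k t ≤ tokenCode k := by
  rw [← partialCode_of_le k (le_max_right t K)]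
  exact partialCode_mono k (le_max_left _ _)

lemma partialCode_succ {K d : ℕ} (k : Fin d → Fin (K + 1)) (t : ℕ) :
    partialCode k (t + 1)
      = partialCode k t + ∑ i : Fin d, (K + 1) ^ (i : ℕ) * (if t < (k i : ℕ) then 1 else 0) := by
  rw [partialCode, partialCode, ← Finset.sum_add_distrib]
  refine Finset.sum_congr rfl fun i _ => ?_
  rw [← mul_add]
  congr 1
  split_ifs <;> omega

/-- What the registers of a token contain at time `t`, when the input is well inside the grid
cells `k`. -/
structure ProgramInvariant {d N K : ℕ} (L T : ℕ) (k : Fin N → Fin d → Fin (K + 1))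
    (w₀ : Fin d → ℝ) (X : Matrix (Fin d) (Fin N) ℝ) (t : ℕ) (n : Fin N) (Y : TokenState d) :
    Prop where
  x_eq : Y.x = fun i => X i n
  t_eq : Y.t = t
  z_eq : Y.z = partialCode (k n) t
  h_eq : t ≤ K + tokenCode (k n) → Y.h = 0
  h_ge : K + tokenCode (k n) < t → 1 ≤ Y.h
  y_eq : Y.y = ((N + 1 : ℕ) : ℝ) ^ min t (K + 1 + tokenCode (k n))
  s_ge : t + L * contextCode k n ≤ T + 1 → 1 ≤ Y.s
  s_eq : T + 2 ≤ t + L * contextCode k n → Y.s = 0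
  w_eq : Y.w = fun i => (gatedTent 0)^[t + L * contextCode k n - (T + 2)] (w₀ i)

lemma programInvariant_iterate {d N K L M T U : ℕ} {a : ℝ} {k : Fin N → Fin d → Fin (K + 1)}
    {w₀ : Fin d → ℝ} {X : Matrix (Fin d) (Fin N) ℝ} (hw₀ : ∀ i, w₀ i ∈ Set.Icc (0 : ℝ) 1)
    (hX : ∀ i n (t : ℕ), ramp a (X i n - t / K) = if t < (k n i : ℕ) then 1 else 0)
    (hM : (N + 1) ^ (K + 2 + (K + 1) ^ d) ≤ M)
    (hU : ∀ n, contextCode k n ≤ U) (hT : K + 1 + (K + 1) ^ d + L * U ≤ T) (t : ℕ) (n : Fin N) :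
    ProgramInvariant L T k w₀ X t n ((programStep K L M T a)^[t] (programInit w₀ X) n) := by
  have hLU (n : Fin N) : L * contextCode k n ≤ L * U := Nat.mul_le_mul_left _ (hU n)
  induction t generalizing n with
  | zero =>
    have := hLU n
    constructor <;> simp [programInit, partialCode] <;> try omega
    rw [Nat.sub_eq_zero_of_le (by omega)]
    rfl
  | succ t ih =>
    rw [Function.iterate_succ_apply']
    set Y := (programStep K L M T a)^[t] (programInit w₀ X)
    have hY := ih n
    have hcode := tokenCode_lt (k n)
    have hLUn := hLU n
    obtain ⟨u, hu, hule, hueq⟩ : ∃ u : ℕ,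
        (K + 1 : ℝ) ^ d * ∑ j, (Y j).y + (Y n).z = u ∧ u ≤ contextCode k n ∧
          (K + 1 + (K + 1) ^ d ≤ t → u = contextCode k n) := by
      refine ⟨(K + 1) ^ d * ∑ j, (N + 1) ^ min t (K + 1 + tokenCode (k j)) + partialCode (k n) t,
        ?_, ?_, fun ht => ?_⟩
      · simp only [fun j => (ih j).y_eq, hY.z_eq]
        push_cast
        rfl
      · refine Nat.add_le_add (Nat.mul_le_mul_left _ (Finset.sum_le_sum fun j _ => ?_))
          (partialCode_le _ _)
        exact Nat.pow_le_pow_right (by omega) (min_le_right _ _)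
      · rw [contextCode, partialCode_of_le _ (by omega)]
        congr 2
        refine Finset.sum_congr rfl fun j _ => ?_
        rw [min_eq_right (by have := tokenCode_lt (k j); omega)]
    have hs : (programStep K L M T a Y n).s = relu (1 + T - (t + L * u : ℕ)) := by
      simp only [programStep, hu, hY.t_eq]
      push_cast
      congr 1
      ring
    have hLu : L * u ≤ L * contextCode k n := Nat.mul_le_mul_left _ hule
    constructor
    · exact hY.x_eq
    · simp [programStep, hY.t_eq]
    · simp only [programStep, hY.z_eq, hY.x_eq, hY.t_eq, hX, partialCode_succ]
      push_cast
      rfl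
    · intro ht
      simp only [programStep, hY.z_eq, hY.t_eq]
      apply relu_of_nonpos
      have : t + 1 ≤ K + partialCode (k n) t := by
        rcases lt_or_ge t K with hK | hK
        · omega
        · rw [partialCode_of_le _ hK]
          exact ht
      have : ((t + 1 : ℕ) : ℝ) ≤ ((K + partialCode (k n) t : ℕ) : ℝ) := by exact_mod_cast this
      push_cast at this
      linarith
    · intro ht
      simp only [programStep, hY.z_eq, hY.t_eq]
      refine le_trans ?_ (le_max_left _ _)
      rw [partialCode_of_le _ (by omega)]
      have : ((K + tokenCode (k n) : ℕ) : ℝ) ≤ (t : ℝ) := by exact_mod_cast Nat.lt_succ_iff.1 ht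
      push_cast at this
      linarith
    · simp only [programStep]
      rcases le_or_gt t (K + tokenCode (k n)) with ht | ht
      · rw [hY.h_eq ht, hY.y_eq, min_eq_left (by omega), min_eq_left (by omega), mul_zero, sub_zero,
          relu_of_nonneg (by positivity), pow_succ]
        push_cast
        ring
      · have hy : (N : ℝ) * (Y n).y ≤ M := by
          rw [hY.y_eq]
          have hpow : N * (N + 1) ^ min t (K + 1 + tokenCode (k n)) ≤ M := by
            refine le_trans ?_ hM
            calc N * (N + 1) ^ min t (K + 1 + tokenCode (k n))
                ≤ (N + 1) * (N + 1) ^ (K + 1 + (K + 1) ^ d) :=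
                  Nat.mul_le_mul (by omega) (Nat.pow_le_pow_right (by omega)
                    ((min_le_right _ _).trans (by omega)))
              _ = (N + 1) ^ (K + 2 + (K + 1) ^ d) := by ring
          exact_mod_cast hpow
        have hMh : (M : ℝ) * 1 ≤ M * (Y n).h := by
          gcongr
          exact hY.h_ge ht
        rw [relu_of_nonpos (by linarith), hY.y_eq, min_eq_right (by omega),
          min_eq_right (by omega), add_zero]
    · intro ht
      rw [hs]
      refine le_trans ?_ (le_max_left _ _)
      have : ((t + L * u : ℕ) : ℝ) ≤ T := by exact_mod_cast (by omega : t + L * u ≤ T)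
      linarith
    · intro ht
      rw [hs]
      apply relu_of_nonpos
      rw [hueq (by omega)]
      have : ((T + 1 : ℕ) : ℝ) ≤ ((t + L * contextCode k n : ℕ) : ℝ) := by
        exact_mod_cast (by omega : T + 1 ≤ t + L * contextCode k n)
      push_cast at this ⊢
      linarith
    · funext i
      simp only [programStep]
      rcases Nat.lt_or_ge (T + 1) (t + L * contextCode k n) with ht | ht
      · rw [hY.s_eq ht, hY.w_eq, ← Function.iterate_succ_apply' (gatedTent 0)]
        congr 1
        omega
      · rw [gatedTent_of_one_le (hY.s_ge ht), hY.w_eq, Nat.sub_eq_zero_of_le (by omega),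
          Nat.sub_eq_zero_of_le (by omega)]
        rw [hY.w_eq, Nat.sub_eq_zero_of_le (by omega)]
        exact (hw₀ i).2

/-! ### Approximation -/

lemma eventually_ramp_eq {K : ℕ} (hK : 0 < K) (x : ℝ) : ∀ᶠ a : ℝ in Filter.atTop, ∀ t : ℕ,
    ramp a (x - t / K) = if t < ⌈K * x⌉₊ then 1 else 0 := by
  have hK' : (0 : ℝ) < K := by exact_mod_cast hK
  have hlt (t : ℕ) : t < ⌈K * x⌉₊ ↔ 0 < x - t / K := by
    rw [Nat.lt_ceil, sub_pos, div_lt_iff₀ hK', mul_comm]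
  have hev : ∀ᶠ a : ℝ in Filter.atTop, ∀ t ∈ Finset.range ⌈K * x⌉₊, 1 ≤ a * (x - t / K) := by
    rw [Filter.eventually_all_finset]
    intro t ht
    have hpos := (hlt t).1 (Finset.mem_range.1 ht)
    filter_upwards [Filter.eventually_ge_atTop (1 / (x - t / K))] with a ha
    rwa [div_le_iff₀ hpos] at ha
  filter_upwards [hev, Filter.eventually_ge_atTop 0] with a ha ha0 t
  split_ifs with ht
  · have h1 := ha t (Finset.mem_range.2 ht)
    rw [ramp, relu_of_nonneg (by linarith), relu_of_nonneg (by linarith)]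
    ring
  · rw [hlt, not_lt] at ht
    have h0 := mul_nonpos_of_nonneg_of_nonpos ha0 ht
    rw [ramp, relu_of_nonpos h0, relu_of_nonpos (by linarith), sub_zero]

lemma isCompact_cube (d N : ℕ) : IsCompact (cube d N) := by
  have h : cube d N = Set.univ.pi fun _ : Fin d => Set.univ.pi fun _ : Fin N =>
      Set.Icc (0 : ℝ) 1 := by
    ext X
    exact ⟨fun h i _ j _ => h i j, fun h i j => h i trivial j trivial⟩
  rw [h]
  exact isCompact_univ_pi fun _ => isCompact_univ_pi fun _ => isCompact_Icc

lemma exists_entry_bound {d N : ℕ} {f : Matrix (Fin d) (Fin N) ℝ → Matrix (Fin d) (Fin N) ℝ}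
    (hf : ContinuousOn f (cube d N)) :
    ∃ D : ℝ, 0 < D ∧ ∀ X ∈ cube d N, ∀ i n, |f X i n| ≤ D := by
  have h (i : Fin d) (n : Fin N) : ∃ D : ℝ, ∀ X ∈ cube d N, |f X i n| ≤ D := by
    have hc : ContinuousOn (fun X => f X i n) (cube d N) := by
      exact (continuous_apply_apply i n).comp_continuousOn hf
    exact (isCompact_cube d N).exists_bound_of_continuousOn hc
  choose D hD using h
  refine ⟨1 + ∑ i, ∑ n, |D i n|, by positivity, fun X hX i n => ?_⟩
  have h1 : |D i n| ≤ ∑ n, |D i n| :=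
    Finset.single_le_sum (f := fun n => |D i n|) (fun _ _ => abs_nonneg _) (Finset.mem_univ n)
  have h2 : ∑ n, |D i n| ≤ ∑ i, ∑ n, |D i n| :=
    Finset.single_le_sum (f := fun i => ∑ n, |D i n|) (fun _ _ => by positivity)
      (Finset.mem_univ i)
  linarith [hD i n X hX, le_abs_self (D i n)]

lemma exists_grid_modulus {d N : ℕ} {f : Matrix (Fin d) (Fin N) ℝ → Matrix (Fin d) (Fin N) ℝ}
    (hf : ContinuousOn f (cube d N)) {η : ℝ} (hη : 0 < η) :
    ∃ K : ℕ, 0 < K ∧ ∀ X ∈ cube d N, ∀ X' ∈ cube d N, (∀ i n, |X i n - X' i n| ≤ 1 / K) →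
      ∀ i n, |f X i n - f X' i n| ≤ η := by
  let f' : (Fin d → Fin N → ℝ) → (Fin d → Fin N → ℝ) := f
  let s : Set (Fin d → Fin N → ℝ) := cube d N
  have hu : UniformContinuousOn f' s :=
    IsCompact.uniformContinuousOn_of_continuous (isCompact_cube d N) hf
  rw [Metric.uniformContinuousOn_iff_le] at hu
  obtain ⟨δ, hδ, h⟩ := hu η hη
  obtain ⟨K, hK⟩ := exists_nat_one_div_lt hδ
  refine ⟨K + 1, K.succ_pos, fun X hX X' hX' hXX' i n => ?_⟩
  have hdist : dist (α := Fin d → Fin N → ℝ) X X' ≤ δ := by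
    refine (dist_pi_le_iff hδ.le).2 fun i => (dist_pi_le_iff hδ.le).2 fun n => ?_
    have := hXX' i n
    push_cast at this
    exact this.trans hK.le
  exact (dist_pi_le_iff hη.le).1 ((dist_pi_le_iff hη.le).1 (h X hX X' hX' hdist) i) n

/-- The grid point with indices `k`. -/
noncomputable def gridPoint {K d N : ℕ} (k : Fin N → Fin d → Fin (K + 1)) :
    Matrix (Fin d) (Fin N) ℝ :=
  Matrix.of fun i n => (k n i : ℝ) / K

lemma gridPoint_mem_cube {K d N : ℕ} (k : Fin N → Fin d → Fin (K + 1)) :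
    gridPoint k ∈ cube d N := by
  intro i n
  refine ⟨by simp only [gridPoint, Matrix.of_apply]; positivity, ?_⟩
  refine div_le_one_of_le₀ ?_ (by positivity)
  exact_mod_cast Nat.lt_succ_iff.1 (k n i).2

lemma exists_table {d N K : ℕ} {f : Matrix (Fin d) (Fin N) ℝ → Matrix (Fin d) (Fin N) ℝ}
    (hP : PermEquivariant f) {D : ℝ} (hD : 0 < D) (hfD : ∀ X ∈ cube d N, ∀ i n, |f X i n| ≤ D) :
    ∃ tbl : ℕ → Fin d → ℝ, (∀ u i, |tbl u i| ≤ D) ∧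
      ∀ (k : Fin N → Fin d → Fin (K + 1)) n i, tbl (contextCode k n) i = f (gridPoint k) i n := by
  classical
  let code : (Fin N → Fin d → Fin (K + 1)) × Fin N → ℕ := fun kn => contextCode kn.1 kn.2
  let val : (Fin N → Fin d → Fin (K + 1)) × Fin N → Fin d → ℝ :=
    fun kn i => f (gridPoint kn.1) i kn.2
  have hfac : val.FactorsThrough code := by
    rintro ⟨k, n⟩ ⟨k', n'⟩ h
    obtain ⟨σ, hσ, rfl⟩ := exists_perm_of_contextCode_eq k k' n n' h
    have hgrid : gridPoint k' = (gridPoint k).submatrix id σ := by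
      ext i j
      simp [gridPoint, hσ]
    funext i
    simp only [val, hgrid, hP σ _ (gridPoint_mem_cube k)]
    rfl
  refine ⟨Function.extend code val 0, fun u i => ?_, fun k n i => ?_⟩
  · rw [Function.extend_def]
    split_ifs
    · exact hfD _ (gridPoint_mem_cube _) _ _
    · simpa using hD.le
  · exact congrFun (hfac.extend_apply 0 (k, n)) i

/-- A fixed program approximates `f` at every point of the cube, once the ramps are steep enough. -/
lemma exists_program_approx {d N : ℕ} {f : Matrix (Fin d) (Fin N) ℝ → Matrix (Fin d) (Fin N) ℝ}
    (hf : ContinuousOn f (cube d N)) (hP : PermEquivariant f) {D : ℝ} (hD : 0 < D)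
    (hfD : ∀ X ∈ cube d N, ∀ i n, |f X i n| ≤ D) {η : ℝ} (hη : 0 < η) :
    ∃ (K L M T r : ℕ) (w₀ : Fin d → ℝ), (∀ i, w₀ i ∈ Set.Icc (0 : ℝ) 1) ∧
      ∀ X ∈ cube d N, ∀ᶠ a : ℝ in Filter.atTop, ∀ i n,
        |2 * D * ((programStep K L M T a)^[r] (programInit w₀ X) n).w i + -D - f X i n| ≤ η := by
  obtain ⟨K, hK, hKf⟩ := exists_grid_modulus hf (half_pos hη)
  obtain ⟨L, hL⟩ := exists_pow_lt_of_lt_one (show 0 < η / (4 * D) by positivity)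
    (show (1 / 2 : ℝ) < 1 by norm_num)
  obtain ⟨tbl, htbl, htblf⟩ := exists_table (K := K) hP hD hfD
  obtain ⟨U, hU⟩ : ∃ U, ∀ (k : Fin N → Fin d → Fin (K + 1)) n, contextCode k n ≤ U := by
    obtain ⟨U, hU⟩ := (Set.finite_range fun kn : (Fin N → Fin d → Fin (K + 1)) × Fin N =>
      contextCode kn.1 kn.2).bddAbove
    exact ⟨U, fun k n => hU ⟨(k, n), rfl⟩⟩
  have htape (i : Fin d) := exists_tent_orbit L U (fun u => (tbl u i + D) / (2 * D)) fun u => by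
    have := abs_le.1 (htbl u i)
    exact ⟨div_nonneg (by linarith) (by linarith),
      div_le_one_of_le₀ (by linarith) (by linarith)⟩
  choose w₀ hw₀ hw using htape
  let M := (N + 1) ^ (K + 2 + (K + 1) ^ d)
  let T := K + 1 + (K + 1) ^ d + L * U
  refine ⟨K, L, M, T, T + 2, w₀, hw₀, fun X hX => ?_⟩
  have hK' : (0 : ℝ) < K := by exact_mod_cast hK
  let k : Fin N → Fin d → Fin (K + 1) := fun n i => ⟨⌈K * X i n⌉₊, by
    refine Nat.lt_succ_of_le (Nat.ceil_le.2 ?_)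
    exact mul_le_of_le_one_right hK'.le (hX i n).2⟩
  have hgrid (i : Fin d) (n : Fin N) : |X i n - gridPoint k i n| ≤ 1 / K := by
    have h0 : 0 ≤ K * X i n := mul_nonneg hK'.le (hX i n).1
    have h1 := Nat.le_ceil (K * X i n)
    have h2 := Nat.ceil_lt_add_one h0
    have h3 : X i n - gridPoint k i n = (K * X i n - ⌈K * X i n⌉₊) / K := by
      simp only [gridPoint, Matrix.of_apply, k]
      field_simp
    rw [h3, abs_div, abs_of_pos hK']
    gcongr
    rw [abs_le]
    constructor <;> linarith
  filter_upwards [Filter.eventually_all.2 fun i => Filter.eventually_all.2 fun n =>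
    eventually_ramp_eq hK (X i n)] with a ha i n
  have hreg := programInvariant_iterate (M := M) (T := T) hw₀ (k := k) (X := X) ha le_rfl (hU k)
    le_rfl (T + 2) n
  rw [hreg.w_eq, Nat.add_sub_cancel_left]
  have h1 := hw i (contextCode k n) (hU k n)
  rw [htblf] at h1
  have h2 := hKf X hX _ (gridPoint_mem_cube k) hgrid i n
  set w := (gatedTent 0)^[L * contextCode k n] (w₀ i)
  set y := f (gridPoint k) i n
  have h3 : 2 * D * w + -D - y = 2 * D * (w - (y + D) / (2 * D)) := by
    field_simp
    ring
  have h4 : |2 * D * w + -D - y| ≤ η / 2 := by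
    rw [h3, abs_mul, abs_of_pos (by positivity : 0 < 2 * D)]
    calc 2 * D * |w - (y + D) / (2 * D)| ≤ 2 * D * (η / (4 * D)) := by
          gcongr
          exact h1.trans hL.le
      _ = η / 2 := by
          field_simp
          norm_num
  rw [abs_le] at h2 h4 ⊢
  constructor <;> linarith [h2.1, h2.2, h4.1, h4.2]

lemma pNorm_rpow {d N : ℕ} {p : ℝ} (hp : 1 ≤ p) (X : Matrix (Fin d) (Fin N) ℝ) :
    pNorm p X ^ p = ∑ i, ∑ n, |X i n| ^ p := by
  rw [pNorm, ← Real.rpow_mul (by positivity), one_div_mul_cancel (by linarith), Real.rpow_one]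

lemma pNorm_rpow_le {d N : ℕ} {p : ℝ} (hp : 1 ≤ p) {X : Matrix (Fin d) (Fin N) ℝ} {c : ℝ}
    (h : ∀ i n, |X i n| ≤ c) : pNorm p X ^ p ≤ d * (N * c ^ p) := by
  rw [pNorm_rpow hp]
  calc ∑ i, ∑ n, |X i n| ^ p ≤ ∑ _i : Fin d, ∑ _n : Fin N, c ^ p := by
        gcongr with i _ n _
        exact h i n
    _ = d * (N * c ^ p) := by simp

/-- Bounded functions on the cube that are pointwise eventually at most `ρ` have eventually an
integral of at most about `ρ`; functions that fail to be measurable have integral zero. -/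
lemma exists_setIntegral_cube_lt {d N : ℕ} {h : ℕ → Matrix (Fin d) (Fin N) ℝ → ℝ} {c ρ e : ℝ}
    (h0 : ∀ n X, 0 ≤ h n X) (hc : ∀ n, ∀ X ∈ cube d N, h n X ≤ c) (he : 0 < e)
    (hρ : ∀ X ∈ cube d N, ∀ᶠ n in Filter.atTop, h n X ≤ ρ)
    (hρe : (volume (cube d N)).toReal * ρ < e) :
    ∃ n, ∫ X in cube d N, h n X < e := by
  have hcomp : IsCompact (X := Fin d → Fin N → ℝ) (cube d N) := isCompact_cube d N
  have hmc : MeasurableSet (cube d N) := hcomp.isClosed.measurableSet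
  have hfin : volume (cube d N) < ⊤ :=
    hcomp.measure_lt_top (μ := (volume : Measure (Fin d → Fin N → ℝ)))
  by_cases hmeas : ∀ n, AEStronglyMeasurable (h n) (volume.restrict (cube d N))
  · have : IsFiniteMeasure (volume.restrict (cube d N)) := ⟨by simpa using hfin⟩
    have hF (n : ℕ) : AEStronglyMeasurable (fun X => max (h n X) ρ)
        (volume.restrict (cube d N)) := (hmeas n).sup aestronglyMeasurable_const
    have hbd (n : ℕ) : ∀ᵐ X ∂volume.restrict (cube d N),
        ‖max (h n X) ρ‖ ≤ |c| + |ρ| := by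
      filter_upwards [ae_restrict_mem hmc] with X hX
      rw [Real.norm_eq_abs, abs_of_nonneg (le_max_of_le_left (h0 n X))]
      exact max_le (by linarith [hc n X hX, le_abs_self c, abs_nonneg ρ])
        (by linarith [le_abs_self ρ, abs_nonneg c])
    have hlim := tendsto_integral_of_dominated_convergence (fun _ => |c| + |ρ|) hF
      (integrable_const _) hbd (f := fun _ => ρ) (by
        filter_upwards [ae_restrict_mem hmc] with X hX
        refine tendsto_const_nhds.congr' ?_
        filter_upwards [hρ X hX] with n hn
        exact (max_eq_right hn).symm)
    rw [setIntegral_const, smul_eq_mul, measureReal_def] at hlim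
    obtain ⟨n, hn⟩ := (hlim.eventually_lt_const hρe).exists
    refine ⟨n, lt_of_le_of_lt ?_ hn⟩
    refine integral_mono_of_nonneg (Filter.Eventually.of_forall (h0 n))
      ((integrable_const (|c| + |ρ|)).mono' (hF n) (hbd n))
      (Filter.Eventually.of_forall fun X => le_max_left _ _)
  · push Not at hmeas
    obtain ⟨n, hn⟩ := hmeas
    refine ⟨n, ?_⟩
    rwa [integral_undef fun hi => hn hi.aestronglyMeasurable]

/-- universality: there is a constant `C > 0` such that the
class of looped Transformers `L₂ ∘ TF^{∘r} ∘ L₁` with embedding dimension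
`m ≤ Cd`, feed-forward width `q ≤ Cd`, two heads, head size 1, arbitrary real
weights, arbitrary loop count `r`, and token-wise affine `L₁ : ℝ^d → ℝ^m`,
`L₂ : ℝ^m → ℝ^d`, is dense in `F_PE([0,1]^{d×N})` in `L^p` norm. -/
theorem looped_transformer_universality (d N : ℕ) (p : ℝ) (hp : 1 ≤ p) :
    ∃ C : ℝ, 0 < C ∧
      ∀ f : Matrix (Fin d) (Fin N) ℝ → Matrix (Fin d) (Fin N) ℝ,
        ContinuousOn f (cube d N) → PermEquivariant f →
        ∀ ε : ℝ, 0 < ε →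
          ∃ (m q : ℕ), (m : ℝ) ≤ C * (d : ℝ) ∧ (q : ℝ) ≤ C * (d : ℝ) ∧
          ∃ (P : TFParams m 1 2 q)
            (A1 : Matrix (Fin m) (Fin d) ℝ) (b1 : Fin m → ℝ)
            (A2 : Matrix (Fin d) (Fin m) ℝ) (b2 : Fin d → ℝ) (r : ℕ),
            LpNormOn p (fun X => loopedNet softmaxCol P A1 b1 A2 b2 r X - f X)
              < ε := by
  rcases Nat.eq_zero_or_pos d with rfl | hd
  · refine ⟨1, one_pos, fun f _ _ ε hε => ⟨0, 0, by simp, by simp,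
      ⟨⟨0, 0, 0, 0⟩, ⟨0, 0, 0, 0⟩⟩, 0, 0, 0, 0, 0, ?_⟩⟩
    have hp0 : p ≠ 0 := by linarith
    simpa [LpNormOn, pNorm, hp0] using hε
  · refine ⟨13, by norm_num, fun f hf hP ε hε => ?_⟩
    have hd' : (1 : ℝ) ≤ d := by exact_mod_cast hd
    have hp0 : 0 < p := by linarith
    refine ⟨2 * d + 6, 4 * d + 9, by push_cast; linarith, by push_cast; linarith, ?_⟩
    obtain ⟨D, hD, hfD⟩ := exists_entry_bound hf
    set V := (volume (cube d N)).toReal with hV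
    have hV0 : 0 ≤ V := ENNReal.toReal_nonneg
    have hεp : 0 < ε ^ p := by positivity
    let η : ℝ := (ε ^ p / ((V + 1) * (d * (N + 1)))) ^ (1 / p)
    have hη : 0 < η := by positivity
    have hηp : V * (d * (N * η ^ p)) < ε ^ p := by
      rw [← Real.rpow_mul (by positivity), one_div_mul_cancel hp0.ne', Real.rpow_one]
      have : V * (d * (N * (ε ^ p / ((V + 1) * (d * (N + 1))))))
          = ε ^ p * (V / (V + 1) * (N / (N + 1))) := by
        field_simp
      rw [this]
      refine mul_lt_of_lt_one_right hεp ?_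
      have h1 : V / (V + 1) < 1 := (div_lt_one (by positivity)).2 (by linarith)
      have h2 : (N : ℝ) / (N + 1) ≤ 1 := (div_le_one (by positivity)).2 (by linarith)
      exact (mul_le_of_le_one_right (by positivity) h2).trans_lt h1
    obtain ⟨K, L, M, T, r, w₀, hw₀, happrox⟩ := exists_program_approx hf hP hD hfD hη
    choose P A1 b1 A2 b2 hnet using fun a : ℝ =>
      exists_loopedNet_eq_program (N := N) K L M T a w₀ (2 * D) (-D)
    obtain ⟨n, hn⟩ := exists_setIntegral_cube_lt (e := ε ^ p) (c := d * (N * (2 * D) ^ p))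
      (h := fun n X =>
        pNorm p (loopedNet softmaxCol (P n) (A1 n) (b1 n) (A2 n) (b2 n) r X - f X) ^ p)
      (fun n X => by rw [pNorm_rpow hp]; positivity)
      (fun n X hX => pNorm_rpow_le hp fun i j => by
        rw [Matrix.sub_apply, hnet]
        have h1 := programStep_iterate_w_mem K L M T n hw₀ X r j i
        have h2 := abs_le.1 (hfD X hX i j)
        have h3 := mul_nonneg (by positivity : 0 ≤ 2 * D) h1.1
        have h4 := mul_le_of_le_one_right (by positivity : 0 ≤ 2 * D) h1.2
        rw [abs_le]
        constructor <;> linarith [h2.1, h2.2])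
      hεp
      (fun X hX => by
        filter_upwards [tendsto_natCast_atTop_atTop.eventually (happrox X hX)] with n hn
        refine pNorm_rpow_le hp fun i j => ?_
        rw [Matrix.sub_apply, hnet]
        exact hn i j)
      hηp
    refine ⟨P n, A1 n, b1 n, A2 n, b2 n, r, ?_⟩
    calc LpNormOn p (fun X =>
          loopedNet softmaxCol (P n) (A1 n) (b1 n) (A2 n) (b2 n) r X - f X)
        < (ε ^ p) ^ (1 / p) := by
          refine Real.rpow_lt_rpow (integral_nonneg fun X => ?_) hn (by positivity)
          simp only [Pi.zero_apply, pNorm_rpow hp]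
          positivity
      _ = ε := by
          rw [← Real.rpow_mul hε.le, mul_one_div_cancel hp0.ne', Real.rpow_one]
end

section
/- Let d, K ∈ ℕ and let y₀, y₁, …, y_{K−1} ∈ ℝ^d and ε₁, …, ε_d ≥ 0 satisfy |(y_k − y_{k−1})_i| ≤ ε_i for every k ∈ {1,…,K−1} and every i ∈ {1,…,d}. Then there exist a feed-forward layer FF: ℝ^{12d} → ℝ^{12d} of width 18d and two affine maps L₁: ℝ → ℝ^{12d}, L₂: ℝ^{12d} → ℝ^d such that for every k ∈ {0,1,…,K−1} and every i ∈ {1,…,d}, |(L₂ ∘ (id + FF)^{∘(K−1)} ∘ L₁(k) − y_k)_i| ≤ ε_i. -/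
/-- The network applying the layer `P i` to the `i`-th block of coordinates. -/
def FFParams.blockDiagonal {m q d : ℕ} (P : Fin d → FFParams m q) :
    FFParams (m * d) (q * d) where
  W1 := (Matrix.blockDiagonal fun i => (P i).W1).submatrix
    finProdFinEquiv.symm finProdFinEquiv.symm
  W2 := (Matrix.blockDiagonal fun i => (P i).W2).submatrix
    finProdFinEquiv.symm finProdFinEquiv.symm
  b1 := fun j => (P (finProdFinEquiv.symm j).2).b1 (finProdFinEquiv.symm j).1
  b2 := fun j => (P (finProdFinEquiv.symm j).2).b2 (finProdFinEquiv.symm j).1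

theorem blockDiagonal_submatrix_mulVec {m q d : ℕ} (M : Fin d → Matrix (Fin q) (Fin m) ℝ)
    (x : Fin (m * d) → ℝ) (a : Fin q) (i : Fin d) :
    ((Matrix.blockDiagonal M).submatrix finProdFinEquiv.symm finProdFinEquiv.symm).mulVec x
      (finProdFinEquiv (a, i)) = (M i).mulVec (fun b => x (finProdFinEquiv (b, i))) a := by
  rw [Matrix.submatrix_mulVec_equiv]
  simp [Matrix.mulVec, dotProduct, Fintype.sum_prod_type, Matrix.blockDiagonal_apply]

theorem FFParams.blockDiagonal_apply {m q d : ℕ} (P : Fin d → FFParams m q)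
    (x : Fin (m * d) → ℝ) (a : Fin m) (i : Fin d) :
    (FFParams.blockDiagonal P).apply x (finProdFinEquiv (a, i)) =
      (P i).apply (fun b => x (finProdFinEquiv (b, i))) a := by
  simp only [FFParams.apply, FFParams.blockDiagonal, Pi.add_apply, blockDiagonal_submatrix_mulVec,
    Equiv.symm_apply_apply]

theorem FFParams.blockDiagonal_iterate {m q d : ℕ} (P : Fin d → FFParams m q) (n : ℕ)
    (x : Fin (m * d) → ℝ) (i : Fin d) :
    (fun a => (fun x => x + (FFParams.blockDiagonal P).apply x)^[n] x (finProdFinEquiv (a, i))) =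
      (fun x => x + (P i).apply x)^[n] (fun a => x (finProdFinEquiv (a, i))) := by
  induction n generalizing x with
  | zero => rfl
  | succ n ih =>
    rw [Function.iterate_succ_apply, Function.iterate_succ_apply, ih]
    congr 1
    funext a
    simp [FFParams.blockDiagonal_apply]

/-- A bounded digit sequence has base-four tails lying in `[0, 2/3]`. -/
theorem exists_base_four_tails (t : ℕ → ℝ) (h0 : ∀ n, 0 ≤ t n) (h2 : ∀ n, t n ≤ 2) :
    ∃ r : ℕ → ℝ, ∀ n, 4 * r n = t (n + 1) + r (n + 1) ∧ 0 ≤ r n ∧ r n ≤ 2 / 3 := by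
  have hg : HasSum (fun j : ℕ => (1 / 2 : ℝ) * (1 / 4) ^ j) (2 / 3) := by
    have h := (hasSum_geometric_of_lt_one (r := (1 / 4 : ℝ)) (by norm_num) (by norm_num)).mul_left
      (1 / 2)
    rwa [show (1 / 2 : ℝ) * (1 - 1 / 4)⁻¹ = 2 / 3 by norm_num] at h
  have hle : ∀ n j, t (n + 1 + j) / 4 * (1 / 4) ^ j ≤ (1 / 2 : ℝ) * (1 / 4) ^ j := fun n j =>
    mul_le_mul_of_nonneg_right (by linarith [h2 (n + 1 + j)]) (by positivity)
  have hnn : ∀ n j, 0 ≤ t (n + 1 + j) / 4 * (1 / 4) ^ j := fun n j => by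
    have := h0 (n + 1 + j)
    positivity
  have hs : ∀ n, Summable fun j : ℕ => t (n + 1 + j) / 4 * (1 / 4) ^ j := fun n =>
    Summable.of_nonneg_of_le (hnn n) (hle n) hg.summable
  refine ⟨fun n => ∑' j : ℕ, t (n + 1 + j) / 4 * (1 / 4) ^ j, fun n => ⟨?_, ?_, ?_⟩⟩
  · simp only
    rw [(hs n).tsum_eq_zero_add, mul_add, ← tsum_mul_left]
    congr 1
    · simp
      ring
    · congr 1
      funext j
      rw [show n + 1 + (j + 1) = n + 1 + 1 + j by ring]
      ring
  · exact tsum_nonneg (hnn n)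
  · exact (Summable.tsum_le_tsum (hle n) (hs n) hg.summable).trans_eq hg.tsum_eq

/-- A layer acting on states `(r, t, c, s)`: it moves the leading base-four digit of `r` into `t`,
decrements the counter `c`, and adds `t - 1` to `s` while the counter is positive. -/
noncomputable def walkCell : FFParams 12 18 where
  W1 := Matrix.of ![![1, 0, 0, 0, 0, 0, 0, 0, 0, 0, 0, 0], ![4, 0, 0, 0, 0, 0, 0, 0, 0, 0, 0, 0],
    ![4, 0, 0, 0, 0, 0, 0, 0, 0, 0, 0, 0], ![4, 0, 0, 0, 0, 0, 0, 0, 0, 0, 0, 0],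
    ![4, 0, 0, 0, 0, 0, 0, 0, 0, 0, 0, 0], ![0, 1, 0, 0, 0, 0, 0, 0, 0, 0, 0, 0],
    ![0, 1, 2, 0, 0, 0, 0, 0, 0, 0, 0, 0], ![0, 0, 2, 0, 0, 0, 0, 0, 0, 0, 0, 0],
    0, 0, 0, 0, 0, 0, 0, 0, 0, 0]
  b1 := ![0, -2 / 3, -1, -5 / 3, -2, 0, -2, -1, 0, 0, 0, 0, 0, 0, 0, 0, 0, 0]
  W2 := Matrix.of ![![3, -3, 3, -3, 3, 0, 0, 0, 0, 0, 0, 0, 0, 0, 0, 0, 0, 0],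
    ![0, 3, -3, 3, -3, -1, 0, 0, 0, 0, 0, 0, 0, 0, 0, 0, 0, 0], 0,
    ![0, 0, 0, 0, 0, 0, 1, -1, 0, 0, 0, 0, 0, 0, 0, 0, 0, 0], 0, 0, 0, 0, 0, 0, 0, 0]
  b2 := ![0, 0, -1, 0, 0, 0, 0, 0, 0, 0, 0, 0]

/-- The state of `walkCell` with the given nonzero entries. -/
def walkState (r t c s : ℝ) : Fin 12 → ℝ := ![r, t, c, s, 0, 0, 0, 0, 0, 0, 0, 0]

/-- The piecewise linear function reading off the leading digit of `r` in base four. -/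
noncomputable def leadingDigit (r : ℝ) : ℝ :=
  3 * relu (4 * r - 2 / 3) - 3 * relu (4 * r - 1) + 3 * relu (4 * r - 5 / 3) - 3 * relu (4 * r - 2)

theorem walkCell_W1_mulVec (r t c s : ℝ) :
    walkCell.W1.mulVec (walkState r t c s) =
      ![r, 4 * r, 4 * r, 4 * r, 4 * r, t, t + 2 * c, 2 * c, 0, 0, 0, 0, 0, 0, 0, 0, 0, 0] := by
  simp [walkState, walkCell, -Matrix.mulVec_cons, mul_comm]

theorem walkCell_W2_mulVec (u₀ u₁ u₂ u₃ u₄ u₅ u₆ u₇ : ℝ) :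
    walkCell.W2.mulVec ![u₀, u₁, u₂, u₃, u₄, u₅, u₆, u₇, 0, 0, 0, 0, 0, 0, 0, 0, 0, 0] =
      ![3 * u₀ - 3 * u₁ + 3 * u₂ - 3 * u₃ + 3 * u₄, 3 * u₁ - 3 * u₂ + 3 * u₃ - 3 * u₄ - u₅, 0,
        u₆ - u₇, 0, 0, 0, 0, 0, 0, 0, 0] := by
  simp [walkCell, -Matrix.mulVec_cons]
  refine ⟨?_, ?_, ?_⟩ <;> ring

theorem walkCell_step (r t c s : ℝ) :
    walkState r t c s + walkCell.apply (walkState r t c s) =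
      walkState (r + 3 * relu r - leadingDigit r) (t - relu t + leadingDigit r) (c - 1)
        (s + relu (2 * c + t - 2) - relu (2 * c - 1)) := by
  have hidden : (fun j => relu (walkCell.W1.mulVec (walkState r t c s) j + walkCell.b1 j)) =
      ![relu r, relu (4 * r - 2 / 3), relu (4 * r - 1), relu (4 * r - 5 / 3), relu (4 * r - 2),
        relu t, relu (2 * c + t - 2), relu (2 * c - 1), 0, 0, 0, 0, 0, 0, 0, 0, 0, 0] := by
    have h0 : relu 0 = 0 := max_self 0
    rw [walkCell_W1_mulVec]
    funext j
    fin_cases j <;> simp [walkCell, h0] <;> ring_nf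
  rw [FFParams.apply, hidden, walkCell_W2_mulVec]
  simp [walkState, walkCell, leadingDigit]
  refine ⟨?_, ?_, ?_, ?_⟩ <;> ring

theorem leadingDigit_eq {r t r' : ℝ} (h : 4 * r = t + r') (h0 : 0 ≤ r') (h1 : r' ≤ 2 / 3)
    (ht : t = 0 ∨ t = 1 ∨ t = 2) : leadingDigit r = t := by
  unfold leadingDigit relu
  rw [h]
  rcases ht with rfl | rfl | rfl
  · rw [max_eq_right, max_eq_right, max_eq_right, max_eq_right] <;> linarith
  · rw [max_eq_left, max_eq_left, max_eq_right, max_eq_right] <;> linarith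
  · rw [max_eq_left, max_eq_left, max_eq_left, max_eq_left] <;> linarith

/-- `walkCell` evaluates every integer walk with increments in `{-1, 0, 1}`. -/
theorem walkCell_iterate (z : ℕ → ℤ) (hz : ∀ n, |z (n + 1) - z n| ≤ 1) :
    ∃ r t s : ℝ, ∀ N k : ℕ, k ≤ N →
      (fun x => x + walkCell.apply x)^[N] (walkState r t k s) 3 = z k := by
  set t : ℕ → ℝ := fun n => z (n + 1) - z n + 1 with ht
  have htd : ∀ n, t n = 0 ∨ t n = 1 ∨ t n = 2 := fun n => by
    have h := abs_le.1 (hz n)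
    have : z (n + 1) = z n - 1 ∨ z (n + 1) = z n ∨ z (n + 1) = z n + 1 := by omega
    rcases this with h | h | h <;> norm_num [ht, h]
  have h0 : ∀ n, 0 ≤ t n := fun n => by rcases htd n with h | h | h <;> norm_num [h]
  have h2 : ∀ n, t n ≤ 2 := fun n => by rcases htd n with h | h | h <;> norm_num [h]
  obtain ⟨r, hr⟩ := exists_base_four_tails t h0 h2
  refine ⟨r 0, t 0, z 0, fun N k hk => ?_⟩
  have key : ∀ n, (fun x => x + walkCell.apply x)^[n] (walkState (r 0) (t 0) k (z 0)) =
      walkState (r n) (t n) (k - n) (z (min n k)) := by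
    intro n
    induction n with
    | zero => simp
    | succ n ih =>
      rw [Function.iterate_succ_apply', ih, walkCell_step,
        leadingDigit_eq (hr n).1 (hr (n + 1)).2.1 (hr (n + 1)).2.2 (htd (n + 1))]
      have e1 : relu (r n) = r n := max_eq_left (hr n).2.1
      have e2 : relu (t n) = t n := max_eq_left (h0 n)
      rw [e1, e2]
      congr 1
      · linarith [(hr n).1]
      · ring
      · push_cast
        ring
      · rcases Nat.lt_or_ge n k with h | h
        · have hc : (n : ℝ) + 1 ≤ k := by exact_mod_cast h
          rw [min_eq_left h.le, min_eq_left (Nat.succ_le_of_lt h), relu, relu,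
            max_eq_left (by linarith [h0 n]), max_eq_left (by linarith)]
          simp only [ht]
          ring
        · have hc : (k : ℝ) ≤ n := by exact_mod_cast h
          rw [min_eq_right h, min_eq_right (h.trans n.le_succ), relu, relu,
            max_eq_right (by linarith [h2 n]), max_eq_right (by linarith)]
          ring
  rw [key, min_eq_right hk]
  rfl

theorem abs_floor_sub_floor_le_one {a b : ℝ} (h : |a - b| ≤ 1) : |⌊a⌋ - ⌊b⌋| ≤ 1 := by
  have h := abs_le.1 h
  have h1 : ⌊a⌋ ≤ ⌊b⌋ + 1 := by
    rw [← Int.floor_add_one]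
    exact Int.floor_mono (by linarith)
  have h2 : ⌊b⌋ ≤ ⌊a⌋ + 1 := by
    rw [← Int.floor_add_one]
    exact Int.floor_mono (by linarith)
  rw [abs_le]
  omega

/-- A real sequence with increments at most `ε` is within `ε` of an affine image of an integer
walk with increments in `{-1, 0, 1}`. -/
theorem exists_integer_walk (y : ℕ → ℝ) {ε : ℝ} (hε : 0 ≤ ε)
    (hy : ∀ n, |y (n + 1) - y n| ≤ ε) :
    ∃ (z : ℕ → ℤ) (α β : ℝ), (∀ n, |z (n + 1) - z n| ≤ 1) ∧ ∀ n, |α * z n + β - y n| ≤ ε := by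
  rcases hε.eq_or_lt with rfl | hpos
  · refine ⟨0, 0, y 0, by simp, fun n => ?_⟩
    have : y n = y 0 := by
      induction n with
      | zero => rfl
      | succ n ih => rw [← ih, ← sub_eq_zero, ← abs_nonpos_iff]; exact hy n
    simp [this]
  · refine ⟨fun n => ⌊y n / ε⌋, ε, 0, fun n => abs_floor_sub_floor_le_one ?_, fun n => ?_⟩
    · rw [← sub_div, abs_div, abs_of_pos hpos, div_le_one hpos]
      exact hy n
    · have h1 := (le_div_iff₀ hpos).1 (Int.floor_le (y n / ε))
      have h2 := (div_lt_iff₀ hpos).1 (Int.lt_floor_add_one (y n / ε))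
      rw [abs_le]
      constructor <;> linarith

/-- Lemma `memorize`: if consecutive labels `y_k ∈ ℝ^d` differ
coordinatewise by at most `ε_i`, there is a feed-forward layer
`FF : ℝ^{12d} → ℝ^{12d}` of width `18d` and affine maps `L₁ : ℝ → ℝ^{12d}`,
`L₂ : ℝ^{12d} → ℝ^d` such that
`|(L₂((id+FF)^{∘(K−1)}(L₁ k)) − y_k)_i| ≤ ε_i` for all `k, i`. -/
theorem memorize (d K : ℕ) (y : Fin K → Fin d → ℝ) (ε : Fin d → ℝ)
    (hε : ∀ i, 0 ≤ ε i)
    (hy : ∀ k : ℕ, (hk : k + 1 < K) → ∀ i : Fin d,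
      |y ⟨k + 1, hk⟩ i - y ⟨k, Nat.lt_of_succ_lt hk⟩ i| ≤ ε i) :
    ∃ (P : FFParams (12 * d) (18 * d))
      (a1 b1 : Fin (12 * d) → ℝ)
      (A2 : Matrix (Fin d) (Fin (12 * d)) ℝ) (b2 : Fin d → ℝ),
      ∀ k : Fin K, ∀ i : Fin d,
        |(A2.mulVec ((fun x => x + P.apply x)^[K - 1]
            (fun j => a1 j * (k : ℝ) + b1 j)) i + b2 i) - y k i| ≤ ε i := by
  rcases Nat.eq_zero_or_pos K with rfl | hK
  · exact ⟨⟨0, 0, 0, 0⟩, 0, 0, 0, 0, fun k => k.elim0⟩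
  have hwalk : ∀ i, ∃ (z : ℕ → ℤ) (α β : ℝ), (∀ n, |z (n + 1) - z n| ≤ 1) ∧
      ∀ n, |α * z n + β - y ⟨min n (K - 1), by omega⟩ i| ≤ ε i := fun i => by
    refine exists_integer_walk (fun n => y ⟨min n (K - 1), by omega⟩ i) (hε i) fun n => ?_
    rcases Nat.lt_or_ge (n + 1) K with h | h
    · convert hy n h i using 6 <;> omega
    · have e1 : min (n + 1) (K - 1) = K - 1 := by omega
      have e2 : min n (K - 1) = K - 1 := by omega
      simpa [e1, e2] using hε i
  choose z α β hz hzy using hwalk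
  choose r t s hcell using fun i => walkCell_iterate (z i) (hz i)
  refine ⟨FFParams.blockDiagonal fun _ => walkCell,
    fun j => walkState 0 0 1 0 (finProdFinEquiv.symm j).1,
    fun j => walkState (r (finProdFinEquiv.symm j).2) (t (finProdFinEquiv.symm j).2) 0
      (s (finProdFinEquiv.symm j).2) (finProdFinEquiv.symm j).1,
    fun i => Pi.single (finProdFinEquiv (3, i)) (α i), β, fun k i => ?_⟩
  have hk : (k : ℕ) ≤ K - 1 := by omega
  have hiter := congrFun (FFParams.blockDiagonal_iterate (fun _ : Fin d => walkCell) (K - 1)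
    (fun j => walkState 0 0 1 0 (finProdFinEquiv.symm j).1 * (k : ℝ) +
      walkState (r (finProdFinEquiv.symm j).2) (t (finProdFinEquiv.symm j).2) 0
        (s (finProdFinEquiv.symm j).2) (finProdFinEquiv.symm j).1) i) 3
  have hinit : (fun a : Fin 12 => walkState 0 0 1 0 a * (k : ℝ) +
      walkState (r i) (t i) 0 (s i) a) = walkState (r i) (t i) k (s i) := by
    funext a
    fin_cases a <;> simp [walkState]
  simp only [Equiv.symm_apply_apply, hinit, hcell i (K - 1) k hk] at hiter
  simp only [Matrix.mulVec, single_dotProduct, hiter]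
  simpa [min_eq_left hk] using hzy i k
end

section
/- Let d, K ∈ ℕ and let y₀, y₁, …, y_{K−1} ∈ ℝ^d be arbitrary. Then there exist a feed-forward layer FF: ℝ^{4d} → ℝ^{4d} of width 6d, vectors η(1), …, η(K−1) ∈ ℝ^{4d}, and two affine maps L₁: ℝ → ℝ^{4d}, L₂: ℝ^{4d} → ℝ^d such that for every k ∈ {0,1,…,K−1}, L₂ ∘ (id + η(K−1)⊙FF) ∘ (id + η(K−2)⊙FF) ∘ ⋯ ∘ (id + η(1)⊙FF) ∘ L₁(k) = y_k exactly (every coordinate of the difference is zero). -/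
/-- `timeModIter P η t` is the composition
`(id + η(t)⊙FF) ∘ ⋯ ∘ (id + η(1)⊙FF)`, where `⊙` is the elementwise
product. -/
def timeModIter {m q : ℕ} (P : FFParams m q) (η : ℕ → Fin m → ℝ) :
    ℕ → (Fin m → ℝ) → (Fin m → ℝ)
  | 0, x => x
  | t + 1, x =>
      let y := timeModIter P η t x
      y + fun j => η (t + 1) j * P.apply y j

/-- Every real sequence agrees on `{0, …, n}` with a combination of the integer shifts of `relu`. -/
lemma exists_sum_relu_eq (g : ℕ → ℝ) (n : ℕ) :
    ∃ c : ℕ → ℝ, ∀ k ≤ n,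
      ∑ t ∈ Finset.range n, c (t + 1) * relu ((k : ℝ) - t) + g 0 = g k := by
  induction n with
  | zero => exact ⟨0, by simp⟩
  | succ n ih =>
    obtain ⟨c, hc⟩ := ih
    let r := g (n + 1) - g 0 -
      ∑ t ∈ Finset.range n, c (t + 1) * relu (((n + 1 : ℕ) : ℝ) - t)
    have hsum (k : ℕ) :
        ∑ t ∈ Finset.range n, Function.update c (n + 1) r (t + 1) * relu ((k : ℝ) - t) =
          ∑ t ∈ Finset.range n, c (t + 1) * relu ((k : ℝ) - t) := by
      refine Finset.sum_congr rfl fun t ht => ?_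
      have := Finset.mem_range.mp ht
      rw [Function.update_of_ne (by omega)]
    refine ⟨Function.update c (n + 1) r, fun k hk => ?_⟩
    rw [Finset.sum_range_succ, hsum, Function.update_self]
    rcases Nat.lt_or_ge n k with h | h
    · obtain rfl : k = n + 1 := by omega
      have hr : relu (((n + 1 : ℕ) : ℝ) - n) = 1 := by simp [relu]
      rw [hr]
      simp only [r]
      ring
    · have hr : relu ((k : ℝ) - n) = 0 := by simpa [relu] using h
      rw [hr, mul_zero, add_zero, hc k h]

/-- The layer on `ℝ^{4d}`, viewed as four blocks of size `d`, that outputs the ReLU of block `1`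
on block `0`, the constant `-1` on block `1`, and `0` elsewhere. -/
noncomputable def counterLayer (d : ℕ) : FFParams (4 * d) (6 * d) where
  W1 := fun q j => if j = finProdFinEquiv (1, (finProdFinEquiv.symm q).2) then 1 else 0
  W2 := fun j q => if q = finProdFinEquiv (0, (finProdFinEquiv.symm j).2) then
    (if (finProdFinEquiv.symm j).1 = 0 then 1 else 0) else 0
  b1 := 0
  b2 := fun j => if (finProdFinEquiv.symm j).1 = 1 then -1 else 0

lemma counterLayer_apply {d : ℕ} (x : Fin (4 * d) → ℝ) (b : Fin 4) (i : Fin d) :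
    (counterLayer d).apply x (finProdFinEquiv (b, i)) =
      (if b = 0 then relu (x (finProdFinEquiv (1, i))) else 0) + if b = 1 then -1 else 0 := by
  simp only [counterLayer, FFParams.apply, Matrix.mulVec, dotProduct, Pi.add_apply,
    Pi.zero_apply, add_zero, ite_mul, zero_mul, one_mul, Finset.sum_ite_eq',
    Finset.mem_univ, if_true, Equiv.symm_apply_apply]

/-- Running `counterLayer` decreases block `1` by one per step, while block `0` accumulates the
scaled ReLUs of the successive values of block `1`. -/
lemma timeModIter_counterLayer {d : ℕ} (c : Fin d → ℕ → ℝ) (x : Fin (4 * d) → ℝ) (i : Fin d)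
    (n : ℕ) :
    let η : ℕ → Fin (4 * d) → ℝ := fun t j =>
      if (finProdFinEquiv.symm j).1 = 0 then c (finProdFinEquiv.symm j).2 t else 1
    timeModIter (counterLayer d) η n x (finProdFinEquiv (1, i)) =
        x (finProdFinEquiv (1, i)) - n ∧
      timeModIter (counterLayer d) η n x (finProdFinEquiv (0, i)) =
        x (finProdFinEquiv (0, i)) +
          ∑ t ∈ Finset.range n, c i (t + 1) * relu (x (finProdFinEquiv (1, i)) - t) := by
  intro η
  have hη₁ (t : ℕ) : η t (finProdFinEquiv (1, i)) = 1 := by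
    simp only [η, Equiv.symm_apply_apply]
    simp
  have hη₀ (t : ℕ) : η t (finProdFinEquiv (0, i)) = c i t := by
    simp only [η, Equiv.symm_apply_apply, if_true]
  induction n with
  | zero => simp [timeModIter]
  | succ n ih =>
    obtain ⟨h₁, h₀⟩ := ih
    constructor
    · simp only [timeModIter, Pi.add_apply, counterLayer_apply, h₁, hη₁]
      simp
      ring
    · simp only [timeModIter, Pi.add_apply, counterLayer_apply, h₁, h₀, hη₀,
        Finset.sum_range_succ]
      simp [add_assoc]

/-- time-dependent exact memorization: for any labels
`y₀,…,y_{K−1} ∈ ℝ^d` there exist a feed-forward layer `FF : ℝ^{4d} → ℝ^{4d}`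
of width `6d`, scaling vectors `η(1),…,η(K−1) ∈ ℝ^{4d}`, and affine maps
`L₁ : ℝ → ℝ^{4d}`, `L₂ : ℝ^{4d} → ℝ^d` with
`L₂((id+η(K−1)⊙FF)∘⋯∘(id+η(1)⊙FF)(L₁ k)) = y_k` exactly. -/
theorem time_dependent_memorize (d K : ℕ) (y : Fin K → Fin d → ℝ) :
    ∃ (P : FFParams (4 * d) (6 * d)) (η : ℕ → Fin (4 * d) → ℝ)
      (a1 b1 : Fin (4 * d) → ℝ)
      (A2 : Matrix (Fin d) (Fin (4 * d)) ℝ) (b2 : Fin d → ℝ),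
      ∀ k : Fin K, ∀ i : Fin d,
        A2.mulVec (timeModIter P η (K - 1)
          (fun j => a1 j * (k : ℝ) + b1 j)) i + b2 i = y k i := by
  let g (i : Fin d) (k : ℕ) : ℝ := if h : k < K then y ⟨k, h⟩ i else 0
  choose c hc using fun i => exists_sum_relu_eq (g i) (K - 1)
  refine ⟨counterLayer d,
    fun t j => if (finProdFinEquiv.symm j).1 = 0 then c (finProdFinEquiv.symm j).2 t else 1,
    fun j => if (finProdFinEquiv.symm j).1 = 1 then 1 else 0, 0,
    fun i j => if j = finProdFinEquiv (0, i) then 1 else 0, fun i => g i 0, fun k i => ?_⟩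
  have hk : g i k = y k i := by simp [g]
  simp only [Matrix.mulVec, dotProduct, ite_mul, zero_mul, one_mul, Finset.sum_ite_eq',
    Finset.mem_univ, if_true]
  rw [(timeModIter_counterLayer c _ i (K - 1)).2, ← hk, ← hc i k (by omega)]
  simp only [Equiv.symm_apply_apply]
  simp
end
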